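/- There exists a real polynomial P₅ of degree at most 4 with leading coefficient 1/24 such that for all real x ≥ e^{57}: |T₅(x) − x·P₅(log x)| < 219.057 · x^{4/5} · (log x)^{6/5}. -/

import Mathlib

open Finset Real

/-- `dk k n` is the number of ways to write `n` as an ordered product of `k`
positive integers (the `k`-fold Dirichlet convolution of the constant
function `1`). -/
noncomputable def dk (k n : ℕ) : ℕ := (ArithmeticFunction.zeta ^ k) n

/-- `Tk k x = ∑_{n ≤ x} d_k(n)`. -/
noncomputable def Tk (k : ℕ) (x : ℝ) : ℝ := ∑ n ∈ Finset.Icc 1 ⌊x⌋₊, (dk k n : ℝ)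

open MeasureTheory Filter Topology

/-- The polynomial `p₀ + p₁ L + p₂ L² / 2! + p₃ L³ / 3!`. -/
noncomputable def cubic (p₀ p₁ p₂ p₃ L : ℝ) : ℝ := p₀ + p₁ * L + p₂ * L ^ 2 / 2 + p₃ * L ^ 3 / 6

/-- The antiderivative of `cubic` that vanishes at `0`. -/
noncomputable def cubicPrim (p₀ p₁ p₂ p₃ L : ℝ) : ℝ :=
  p₀ * L + p₁ * L ^ 2 / 2 + p₂ * L ^ 3 / 6 + p₃ * L ^ 4 / 24

/-- The centred sawtooth function. -/
noncomputable def saw (u : ℝ) : ℝ := Int.fract u - 1 / 2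

lemma abs_saw_le (u : ℝ) : |saw u| ≤ 1 / 2 := by
  have h0 := Int.fract_nonneg u
  have h1 := (Int.fract_lt_one u).le
  rw [saw, abs_le]
  constructor <;> linarith

lemma measurable_saw : Measurable saw := measurable_fract.sub_const _

lemma natFloor_eq_sub_saw {u : ℝ} (hu : 0 ≤ u) : (⌊u⌋₊ : ℝ) = u - 1 / 2 - saw u := by
  rw [saw, ← Int.self_sub_floor, natCast_floor_eq_intCast_floor hu]
  ring

lemma hasDerivAt_cubic (p₀ p₁ p₂ p₃ L : ℝ) :
    HasDerivAt (cubic p₀ p₁ p₂ p₃) (cubic p₁ p₂ p₃ 0 L) L := by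
  unfold cubic
  have h1 := (hasDerivAt_id L).const_mul p₁
  have h2 := (((hasDerivAt_id L).pow 2).const_mul p₂).div_const 2
  have h3 := (((hasDerivAt_id L).pow 3).const_mul p₃).div_const 6
  convert! ((h1.const_add p₀).add h2).add h3 using 1
  simp
  ring

lemma hasDerivAt_cubicPrim (p₀ p₁ p₂ p₃ L : ℝ) :
    HasDerivAt (cubicPrim p₀ p₁ p₂ p₃) (cubic p₀ p₁ p₂ p₃ L) L := by
  unfold cubic cubicPrim
  have h0 := (hasDerivAt_id L).const_mul p₀
  have h1 := (((hasDerivAt_id L).pow 2).const_mul p₁).div_const 2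
  have h2 := (((hasDerivAt_id L).pow 3).const_mul p₂).div_const 6
  have h3 := (((hasDerivAt_id L).pow 4).const_mul p₃).div_const 24
  convert! ((h0.add h1).add h2).add h3 using 1
  simp
  ring

lemma continuous_cubic (p₀ p₁ p₂ p₃ : ℝ) : Continuous (cubic p₀ p₁ p₂ p₃) := by
  unfold cubic
  fun_prop

lemma abs_cubic_le {p₀ p₁ p₂ p₃ b₀ b₁ b₂ b₃ L : ℝ} (hL : 0 ≤ L) (h₀ : |p₀| ≤ b₀) (h₁ : |p₁| ≤ b₁)
    (h₂ : |p₂| ≤ b₂) (h₃ : |p₃| ≤ b₃) : |cubic p₀ p₁ p₂ p₃ L| ≤ cubic b₀ b₁ b₂ b₃ L := by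
  unfold cubic
  have e1 : |p₁ * L| ≤ b₁ * L := by
    rw [abs_mul, abs_of_nonneg hL]; gcongr
  have e2 : |p₂ * L ^ 2 / 2| ≤ b₂ * L ^ 2 / 2 := by
    rw [abs_div, abs_mul, abs_of_nonneg (pow_nonneg hL 2), abs_of_pos (zero_lt_two' ℝ)]; gcongr
  have e3 : |p₃ * L ^ 3 / 6| ≤ b₃ * L ^ 3 / 6 := by
    rw [abs_div, abs_mul, abs_of_nonneg (pow_nonneg hL 3), abs_of_pos (by norm_num : (0 : ℝ) < 6)]
    gcongr
  refine (abs_add_le _ _).trans (add_le_add ((abs_add_le _ _).trans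
    (add_le_add ((abs_add_le _ _).trans (add_le_add h₀ e1)) e2)) e3)

lemma cubic_nonneg {p₀ p₁ p₂ p₃ L : ℝ} (hL : 0 ≤ L) (h₀ : 0 ≤ p₀) (h₁ : 0 ≤ p₁)
    (h₂ : 0 ≤ p₂) (h₃ : 0 ≤ p₃) : 0 ≤ cubic p₀ p₁ p₂ p₃ L := by
  unfold cubic
  positivity

lemma tendsto_cubic_log_div (p₀ p₁ p₂ p₃ : ℝ) :
    Tendsto (fun v ↦ cubic p₀ p₁ p₂ p₃ (log v) / v) atTop (𝓝 0) := by
  have h (n : ℕ) : Tendsto (fun v : ℝ ↦ log v ^ n / v) atTop (𝓝 0) :=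
    (isLittleO_pow_log_id_atTop (n := n)).tendsto_div_nhds_zero
  have := ((((h 0).const_mul p₀).add ((h 1).const_mul p₁)).add ((h 2).const_mul (p₂ / 2))).add
    ((h 3).const_mul (p₃ / 6))
  simp only [mul_zero, add_zero] at this
  refine this.congr fun v ↦ ?_
  unfold cubic
  ring

/-- Integration of a polynomial in `log (u / z)` against `u⁻²` over `(z, ∞)`. -/
lemma integral_cubic_log_div_sq {z : ℝ} (hz : 0 < z) (w₀ w₁ w₂ w₃ : ℝ)
    (h₀ : w₁ ≤ w₀) (h₁ : w₂ ≤ w₁) (h₂ : w₃ ≤ w₂) (h₃ : 0 ≤ w₃) :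
    IntegrableOn (fun u ↦ cubic (w₀ - w₁) (w₁ - w₂) (w₂ - w₃) w₃ (log (u / z)) / u ^ 2)
      (Set.Ioi z) ∧
    ∫ u in Set.Ioi z, cubic (w₀ - w₁) (w₁ - w₂) (w₂ - w₃) w₃ (log (u / z)) / u ^ 2 = w₀ / z := by
  have hd : ∀ u ∈ Set.Ici z, HasDerivAt (fun u ↦ -(cubic w₀ w₁ w₂ w₃ (log (u / z)) / u))
      (cubic (w₀ - w₁) (w₁ - w₂) (w₂ - w₃) w₃ (log (u / z)) / u ^ 2) u := by
    intro u hu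
    have hu0 : 0 < u := hz.trans_le hu
    have hl : HasDerivAt (fun u ↦ log (u / z)) (1 / u) u := by
      convert! ((hasDerivAt_id u).div_const z).log (div_pos hu0 hz).ne' using 1
      simp; field_simp
    have := (((hasDerivAt_cubic w₀ w₁ w₂ w₃ _).comp u hl).div (hasDerivAt_id u) hu0.ne').neg
    convert! this using 1
    simp only [Function.comp, id, cubic]
    field_simp
    ring
  have hpos : ∀ u ∈ Set.Ioi z,
      0 ≤ cubic (w₀ - w₁) (w₁ - w₂) (w₂ - w₃) w₃ (log (u / z)) / u ^ 2 := by
    intro u hu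
    have : 0 ≤ log (u / z) := log_nonneg ((one_le_div hz).2 (le_of_lt hu))
    have := cubic_nonneg this (sub_nonneg.2 h₀) (sub_nonneg.2 h₁) (sub_nonneg.2 h₂) h₃
    positivity
  have ht : Tendsto (fun u ↦ -(cubic w₀ w₁ w₂ w₃ (log (u / z)) / u)) atTop (𝓝 0) := by
    have h := ((tendsto_cubic_log_div w₀ w₁ w₂ w₃).comp
      (tendsto_id.atTop_div_const hz)).const_mul (-(1 / z))
    rw [mul_zero] at h
    refine h.congr fun u ↦ ?_
    simp only [Function.comp, id]
    field_simp
  refine ⟨integrableOn_Ioi_deriv_of_nonneg' hd hpos ht, ?_⟩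
  rw [integral_Ioi_of_hasDerivAt_of_nonneg' hd hpos ht]
  simp [hz.ne', cubic]

lemma integral_saw_mul_cubic {z : ℝ} (hz : 0 < z) (w₀ w₁ w₂ w₃ : ℝ)
    (h₀ : w₁ ≤ w₀) (h₁ : w₂ ≤ w₁) (h₂ : w₃ ≤ w₂) (h₃ : 0 ≤ w₃) :
    IntegrableOn
      (fun u ↦ saw u * (cubic (w₀ - w₁) (w₁ - w₂) (w₂ - w₃) w₃ (log (u / z)) / u ^ 2))
      (Set.Ioi z) ∧
    |∫ u in Set.Ioi z, saw u * (cubic (w₀ - w₁) (w₁ - w₂) (w₂ - w₃) w₃ (log (u / z)) / u ^ 2)| ≤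
      w₀ / z / 2 := by
  obtain ⟨hi, he⟩ := integral_cubic_log_div_sq hz w₀ w₁ w₂ w₃ h₀ h₁ h₂ h₃
  have hI : IntegrableOn
      (fun u ↦ saw u * (cubic (w₀ - w₁) (w₁ - w₂) (w₂ - w₃) w₃ (log (u / z)) / u ^ 2))
      (Set.Ioi z) :=
    hi.bdd_mul (c := 1 / 2) measurable_saw.aestronglyMeasurable (ae_of_all _ abs_saw_le)
  refine ⟨hI, ?_⟩
  rw [← he, ← Real.norm_eq_abs, div_eq_mul_inv _ (2 : ℝ), ← integral_mul_const]
  refine norm_integral_le_of_norm_le (hi.mul_const _) ?_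
  refine (ae_restrict_iff' measurableSet_Ioi).2 (ae_of_all _ fun u hu ↦ ?_)
  have hl : 0 ≤ log (u / z) := log_nonneg ((one_le_div hz).2 (le_of_lt hu))
  have := cubic_nonneg hl (sub_nonneg.2 h₀) (sub_nonneg.2 h₁) (sub_nonneg.2 h₂) h₃
  have h : 0 ≤ cubic (w₀ - w₁) (w₁ - w₂) (w₂ - w₃) w₃ (log (u / z)) / u ^ 2 := by positivity
  rw [norm_mul, Real.norm_of_nonneg h, Real.norm_eq_abs, mul_comm]
  have := abs_saw_le u
  gcongr
  linarith

/-- The integrals of a polynomial in `s - log (u / z)` against `u⁻²` times the sawtooth,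
expanded around `s`. -/
lemma exists_integral_saw_mul_cubic_sub {z : ℝ} (hz : 0 < z) :
    ∃ k₀ k₁ k₂ k₃ : ℝ, |k₀| ≤ 1 / z / 2 ∧ |k₁| ≤ 1 / z / 2 ∧ |k₂| ≤ 1 / z / 2 ∧ |k₃| ≤ 1 / z / 2 ∧
      ∀ r₀ r₁ r₂ r₃ s : ℝ,
        IntegrableOn (fun u ↦ saw u * (cubic r₀ r₁ r₂ r₃ (s - log (u / z)) / u ^ 2))
          (Set.Ioi z) ∧
        ∫ u in Set.Ioi z, saw u * (cubic r₀ r₁ r₂ r₃ (s - log (u / z)) / u ^ 2) =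
          cubic r₀ r₁ r₂ r₃ s * k₀ - cubic r₁ r₂ r₃ 0 s * k₁ + cubic r₂ r₃ 0 0 s * k₂ -
            r₃ * k₃ := by
  obtain ⟨i₀, e₀⟩ := integral_saw_mul_cubic hz 1 0 0 0 (by simp) (by simp) (by simp) (by simp)
  obtain ⟨i₁, e₁⟩ := integral_saw_mul_cubic hz 1 1 0 0 (by simp) (by simp) (by simp) (by simp)
  obtain ⟨i₂, e₂⟩ := integral_saw_mul_cubic hz 1 1 1 0 (by simp) (by simp) (by simp) (by simp)
  obtain ⟨i₃, e₃⟩ := integral_saw_mul_cubic hz 1 1 1 1 (by simp) (by simp) (by simp) (by simp)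
  refine ⟨_, _, _, _, e₀, e₁, e₂, e₃, fun r₀ r₁ r₂ r₃ s ↦ ?_⟩
  have hf : (fun u ↦ saw u * (cubic r₀ r₁ r₂ r₃ (s - log (u / z)) / u ^ 2)) = fun u ↦
      cubic r₀ r₁ r₂ r₃ s *
        (saw u * (cubic (1 - 0) (0 - 0) (0 - 0) 0 (log (u / z)) / u ^ 2)) -
      cubic r₁ r₂ r₃ 0 s *
        (saw u * (cubic (1 - 1) (1 - 0) (0 - 0) 0 (log (u / z)) / u ^ 2)) +
      cubic r₂ r₃ 0 0 s *
        (saw u * (cubic (1 - 1) (1 - 1) (1 - 0) 0 (log (u / z)) / u ^ 2)) -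
      r₃ * (saw u * (cubic (1 - 1) (1 - 1) (1 - 1) 1 (log (u / z)) / u ^ 2)) := by
    funext u
    unfold cubic
    ring
  have j₀ := i₀.const_mul (cubic r₀ r₁ r₂ r₃ s)
  have j₁ := i₁.const_mul (cubic r₁ r₂ r₃ 0 s)
  have j₂ := i₂.const_mul (cubic r₂ r₃ 0 0 s)
  have j₃ := i₃.const_mul r₃
  refine ⟨?_, ?_⟩
  · rw [hf]
    exact ((j₀.sub j₁).add j₂).sub j₃
  · have s₁ := integral_sub j₀ j₁
    have s₂ := integral_add (j₀.sub j₁) j₂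
    have s₃ := integral_sub ((j₀.sub j₁).add j₂) j₃
    simp only [Pi.add_apply, Pi.sub_apply] at s₁ s₂ s₃
    rw [hf, s₃, s₂, s₁]
    simp only [integral_const_mul]

/-- Abel summation over `1 ≤ n ≤ b`. -/
lemma sum_mul_eq_sub_integral (c : ℕ → ℝ) {f f' : ℝ → ℝ} {b : ℝ}
    (hf : ∀ t ∈ Set.Icc 1 b, HasDerivAt f (f' t) t) (hf' : ContinuousOn f' (Set.Icc 1 b)) :
    ∑ n ∈ Icc 1 ⌊b⌋₊, f n * c n =
      f b * ∑ n ∈ Icc 1 ⌊b⌋₊, c n - ∫ t in Set.Ioc 1 b, f' t * ∑ n ∈ Icc 1 ⌊t⌋₊, c n := by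
  let c' : ℕ → ℝ := fun n ↦ if n = 0 then 0 else c n
  have hc (g : ℕ → ℝ) (N : ℕ) : ∑ n ∈ Icc 0 N, g n * c' n = ∑ n ∈ Icc 1 N, g n * c n := by
    rw [← Finset.add_sum_Ioc_eq_sum_Icc (Nat.zero_le N), ← Finset.Icc_add_one_left_eq_Ioc]
    simp only [c', if_true, mul_zero, zero_add]
    exact sum_congr rfl fun n hn ↦ by rw [if_neg (by have := (mem_Icc.1 hn).1; omega)]
  have hc1 (N : ℕ) : ∑ n ∈ Icc 0 N, c' n = ∑ n ∈ Icc 1 N, c n := by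
    simpa using hc (fun _ ↦ 1) N
  have hd : Set.EqOn f' (deriv f) (Set.Icc 1 b) := fun t ht ↦ (hf t ht).deriv.symm
  have h := _root_.sum_mul_eq_sub_integral_mul₀ (f := f) (c := c') (by simp [c']) b
    (fun t ht ↦ (hf t ht).differentiableAt)
    (hf'.integrableOn_Icc.congr_fun hd measurableSet_Icc)
  simp only [hc1] at h
  rw [← hc (fun n ↦ f n), h]
  congr 1
  refine setIntegral_congr_fun measurableSet_Ioc fun t ht ↦ ?_
  simp only [hd (Set.Ioc_subset_Icc_self ht)]

lemma sum_cubic_log_div_eq {x z : ℝ} (hz : 1 ≤ z) (hx : 0 < x) (p₀ p₁ p₂ p₃ : ℝ) :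
    ∑ m ∈ Icc 1 ⌊z⌋₊, cubic p₀ p₁ p₂ p₃ (log (x / m)) / m =
      -saw z * (cubic p₀ p₁ p₂ p₃ (log (x / z)) / z) + cubic p₀ p₁ p₂ p₃ (log x) / 2 +
        cubicPrim p₀ p₁ p₂ p₃ (log x) - cubicPrim p₀ p₁ p₂ p₃ (log (x / z)) -
        ∫ u in Set.Ioc 1 z,
          saw u * (cubic (p₀ + p₁) (p₁ + p₂) (p₂ + p₃) p₃ (log (x / u)) / u ^ 2) := by
  have hl (u : ℝ) (hu : 0 < u) : HasDerivAt (fun u ↦ log (x / u)) (-1 / u) u := by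
    have : (fun u ↦ log (x / u)) =ᶠ[𝓝 u] fun u ↦ log x - log u := by
      filter_upwards [lt_mem_nhds hu] with v hv using log_div hx.ne' hv.ne'
    refine HasDerivAt.congr_of_eventuallyEq ?_ this
    convert! (hasDerivAt_log hu.ne').const_sub (log x) using 1
    ring
  have hpos {u : ℝ} (hu : u ∈ Set.Icc 1 z) : 0 < u := zero_lt_one.trans_le hu.1
  set f : ℝ → ℝ := fun u ↦ cubic p₀ p₁ p₂ p₃ (log (x / u)) / u with hf
  set f' : ℝ → ℝ := fun u ↦
    -(cubic (p₀ + p₁) (p₁ + p₂) (p₂ + p₃) p₃ (log (x / u)) / u ^ 2) with hf'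
  have hd : ∀ u ∈ Set.Icc 1 z, HasDerivAt f (f' u) u := by
    intro u hu
    have hu0 := hpos hu
    have := ((hasDerivAt_cubic p₀ p₁ p₂ p₃ _).comp u (hl u hu0)).div (hasDerivAt_id u) hu0.ne'
    convert! this using 1
    simp only [Function.comp, id, cubic, hf']
    field_simp
    ring
  have hc : ContinuousOn f' (Set.Icc 1 z) := by
    have h1 : ContinuousOn (fun u ↦ log (x / u)) (Set.Icc 1 z) := fun u hu ↦
      (hl u (hpos hu)).continuousAt.continuousWithinAt
    refine (((continuous_cubic _ _ _ _).comp_continuousOn h1).div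
      (continuousOn_id.pow 2) fun u hu ↦ ?_).neg
    exact pow_ne_zero 2 (hpos hu).ne'
  have hF : ∀ u ∈ Set.Icc 1 z, HasDerivAt
      (fun u ↦ (u - 1 / 2) * f u + cubicPrim p₀ p₁ p₂ p₃ (log (x / u))) (f' u * (u - 1 / 2)) u := by
    intro u hu
    have hu0 := hpos hu
    have := (((hasDerivAt_id u).sub_const (1 / 2)).mul (hd u hu)).add
      ((hasDerivAt_cubicPrim p₀ p₁ p₂ p₃ _).comp u (hl u hu0))
    convert! this using 1
    simp only [id, hf]
    field_simp
    ring
  have hc2 : ContinuousOn (fun u ↦ f' u * (u - 1 / 2)) (Set.Icc 1 z) :=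
    hc.mul (continuousOn_id.sub continuousOn_const)
  have hFTC : ∫ u in Set.Ioc 1 z, f' u * (u - 1 / 2) =
      ((z - 1 / 2) * f z + cubicPrim p₀ p₁ p₂ p₃ (log (x / z))) -
        ((1 - 1 / 2) * f 1 + cubicPrim p₀ p₁ p₂ p₃ (log (x / 1))) := by
    rw [← intervalIntegral.integral_of_le hz]
    refine intervalIntegral.integral_eq_sub_of_hasDerivAt (fun u hu ↦ hF u ?_) ?_
    · rwa [Set.uIcc_of_le hz] at hu
    · exact hc2.intervalIntegrable_of_Icc hz
  have i1 : IntegrableOn (fun u ↦ f' u * (u - 1 / 2)) (Set.Ioc 1 z) :=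
    hc2.integrableOn_Icc.mono_set Set.Ioc_subset_Icc_self
  have i2 : IntegrableOn (fun u ↦ saw u * f' u) (Set.Ioc 1 z) :=
    (hc.integrableOn_Icc.mono_set Set.Ioc_subset_Icc_self).bdd_mul (c := 1 / 2)
      measurable_saw.aestronglyMeasurable (ae_of_all _ abs_saw_le)
  have hA := sum_mul_eq_sub_integral (fun _ ↦ 1) hd hc
  simp only [mul_one, sum_const, Nat.card_Icc, Nat.add_sub_cancel, nsmul_eq_mul] at hA
  have hI : ∫ t in Set.Ioc 1 z, f' t * (⌊t⌋₊ : ℝ) =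
      (∫ t in Set.Ioc 1 z, f' t * (t - 1 / 2)) - ∫ t in Set.Ioc 1 z, saw t * f' t := by
    rw [← integral_sub i1 i2]
    refine setIntegral_congr_fun measurableSet_Ioc fun t ht ↦ ?_
    have := natFloor_eq_sub_saw (zero_lt_one.trans ht.1).le
    simp only [this]
    ring
  have hS : ∫ u in Set.Ioc 1 z, saw u * f' u = -∫ u in Set.Ioc 1 z,
      saw u * (cubic (p₀ + p₁) (p₁ + p₂) (p₂ + p₃) p₃ (log (x / u)) / u ^ 2) := by
    rw [← integral_neg]
    exact integral_congr_ae (ae_of_all _ fun u ↦ by simp only [hf']; ring)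
  rw [hA, hI, hFTC, hS, natFloor_eq_sub_saw (by linarith)]
  simp only [hf, div_one]
  ring

lemma abs_alternating_le {A B C D a b c d : ℝ} (hA : |A| ≤ a) (hB : |B| ≤ b) (hC : |C| ≤ c)
    (hD : |D| ≤ d) : |A - B + C - D| ≤ a + b + c + d := by
  refine (abs_sub _ _).trans (add_le_add ((abs_add_le _ _).trans
    (add_le_add ((abs_sub _ _).trans (add_le_add hA hB)) hC)) hD)

/-- Euler–Maclaurin summation for a polynomial in `log (x / m)` divided by `m`. -/
lemma exists_sum_cubic_log_div {p₀ p₁ p₂ p₃ b₀ b₁ b₂ b₃ : ℝ} (h₀ : |p₀| ≤ b₀) (h₁ : |p₁| ≤ b₁)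
    (h₂ : |p₂| ≤ b₂) (h₃ : |p₃| ≤ b₃) :
    ∃ g₀ g₁ g₂ g₃ : ℝ, |g₀| ≤ b₀ + 2 * b₁ + 2 * b₂ + 2 * b₃ ∧ |g₁| ≤ b₁ + 2 * b₂ + 2 * b₃ ∧
      |g₂| ≤ b₂ + 2 * b₃ ∧ |g₃| ≤ b₃ ∧ ∀ x z : ℝ, 1 ≤ z → z ≤ x →
      |∑ m ∈ Icc 1 ⌊z⌋₊, cubic p₀ p₁ p₂ p₃ (log (x / m)) / m -
        (-saw z * (cubic p₀ p₁ p₂ p₃ (log (x / z)) / z) + cubicPrim p₀ p₁ p₂ p₃ (log x) -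
          cubicPrim p₀ p₁ p₂ p₃ (log (x / z)) + cubic g₀ g₁ g₂ g₃ (log x))| ≤
      cubic (b₀ + 2 * b₁ + 2 * b₂ + 2 * b₃) (b₁ + 2 * b₂ + 2 * b₃) (b₂ + 2 * b₃) b₃ (log (x / z)) *
        (1 / z / 2) := by
  obtain ⟨k₀, k₁, k₂, k₃, hk₀, hk₁, hk₂, hk₃, hk⟩ := exists_integral_saw_mul_cubic_sub zero_lt_one
  have a₀ : |p₀ + p₁| ≤ b₀ + b₁ := (abs_add_le _ _).trans (add_le_add h₀ h₁)
  have a₁ : |p₁ + p₂| ≤ b₁ + b₂ := (abs_add_le _ _).trans (add_le_add h₁ h₂)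
  have a₂ : |p₂ + p₃| ≤ b₂ + b₃ := (abs_add_le _ _).trans (add_le_add h₂ h₃)
  have n₀ : 0 ≤ b₀ := (abs_nonneg _).trans h₀
  have n₁ : 0 ≤ b₁ := (abs_nonneg _).trans h₁
  have n₂ : 0 ≤ b₂ := (abs_nonneg _).trans h₂
  have n₃ : 0 ≤ b₃ := (abs_nonneg _).trans h₃
  have hm {r s k c : ℝ} (hr : |r| ≤ s) (hk : |k| ≤ c) : |r * k| ≤ s * c := by
    rw [abs_mul]
    exact mul_le_mul hr hk (abs_nonneg _) ((abs_nonneg _).trans hr)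
  have hh {p b : ℝ} (h : |p| ≤ b) : |p / 2| ≤ b / 2 := by
    rw [abs_div, abs_of_pos (zero_lt_two' ℝ)]; gcongr
  refine ⟨p₀ / 2 - ((p₀ + p₁) * k₀ - (p₁ + p₂) * k₁ + (p₂ + p₃) * k₂ - p₃ * k₃),
    p₁ / 2 - ((p₁ + p₂) * k₀ - (p₂ + p₃) * k₁ + p₃ * k₂),
    p₂ / 2 - ((p₂ + p₃) * k₀ - p₃ * k₁), p₃ / 2 - p₃ * k₀, ?_, ?_, ?_, ?_, ?_⟩
  · refine (abs_sub _ _).trans ?_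
    linarith [hh h₀, abs_alternating_le (hm a₀ hk₀) (hm a₁ hk₁) (hm a₂ hk₂) (hm h₃ hk₃)]
  · have := abs_alternating_le (hm a₁ hk₀) (hm a₂ hk₁) (hm h₃ hk₂) (abs_zero (α := ℝ)).le
    rw [sub_zero] at this
    refine (abs_sub _ _).trans ?_
    linarith [hh h₁]
  · refine (abs_sub _ _).trans ?_
    linarith [hh h₂, (abs_sub ((p₂ + p₃) * k₀) (p₃ * k₁)), hm a₂ hk₀, hm h₃ hk₁]
  · refine (abs_sub _ _).trans ?_
    linarith [hh h₃, hm h₃ hk₀]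
  intro x z hz hzx
  have hz0 : 0 < z := zero_lt_one.trans_le hz
  have hx0 : 0 < x := hz0.trans_le hzx
  have hL : 0 ≤ log (x / z) := log_nonneg ((one_le_div hz0).2 hzx)
  obtain ⟨l₀, l₁, l₂, l₃, hl₀, hl₁, hl₂, hl₃, hl⟩ := exists_integral_saw_mul_cubic_sub hz0
  obtain ⟨i1, e1⟩ := hk (p₀ + p₁) (p₁ + p₂) (p₂ + p₃) p₃ (log x)
  obtain ⟨-, e2⟩ := hl (p₀ + p₁) (p₁ + p₂) (p₂ + p₃) p₃ (log (x / z))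
  have c1 : Set.EqOn
      (fun u ↦ saw u * (cubic (p₀ + p₁) (p₁ + p₂) (p₂ + p₃) p₃ (log x - log (u / 1)) / u ^ 2))
      (fun u ↦ saw u * (cubic (p₀ + p₁) (p₁ + p₂) (p₂ + p₃) p₃ (log (x / u)) / u ^ 2))
      (Set.Ioi 1) := by
    intro u hu
    have : u ≠ 0 := (zero_lt_one.trans hu).ne'
    simp only [div_one, log_div hx0.ne' this]
  have c2 : Set.EqOn
      (fun u ↦ saw u *
        (cubic (p₀ + p₁) (p₁ + p₂) (p₂ + p₃) p₃ (log (x / z) - log (u / z)) / u ^ 2))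
      (fun u ↦ saw u * (cubic (p₀ + p₁) (p₁ + p₂) (p₂ + p₃) p₃ (log (x / u)) / u ^ 2))
      (Set.Ioi z) := by
    intro u hu
    have : u ≠ 0 := (hz0.trans hu).ne'
    simp only [log_div hx0.ne' this, log_div hx0.ne' hz0.ne', log_div this hz0.ne']
    ring_nf
  rw [setIntegral_congr_fun measurableSet_Ioi c1] at e1
  rw [setIntegral_congr_fun measurableSet_Ioi c2] at e2
  have i1 := i1.congr_fun c1 measurableSet_Ioi
  have hsplit := setIntegral_union (Set.Ioc_disjoint_Ioi le_rfl) measurableSet_Ioi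
    (i1.mono_set (Set.Ioc_subset_Ioi_self : Set.Ioc 1 z ⊆ _)) (i1.mono_set (Set.Ioi_subset_Ioi hz))
  rw [Set.Ioc_union_Ioi_eq_Ioi hz, e1, e2] at hsplit
  rw [sum_cubic_log_div_eq hz hx0, ← sub_eq_iff_eq_add.2 hsplit]
  have t₀ := hm (abs_cubic_le hL a₀ a₁ a₂ h₃) hl₀
  have t₁ := hm (abs_cubic_le hL a₁ a₂ h₃ (abs_zero (α := ℝ)).le) hl₁
  have t₂ := hm (abs_cubic_le hL a₂ h₃ (abs_zero (α := ℝ)).le (abs_zero (α := ℝ)).le) hl₂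
  have t₃ := hm h₃ hl₃
  have hw : cubic (b₀ + 2 * b₁ + 2 * b₂ + 2 * b₃) (b₁ + 2 * b₂ + 2 * b₃) (b₂ + 2 * b₃) b₃
      (log (x / z)) = cubic (b₀ + b₁) (b₁ + b₂) (b₂ + b₃) b₃ (log (x / z)) +
        cubic (b₁ + b₂) (b₂ + b₃) b₃ 0 (log (x / z)) + cubic (b₂ + b₃) b₃ 0 0 (log (x / z)) +
        b₃ := by
    unfold cubic
    ring
  refine (le_of_eq (congrArg _ ?_)).trans
    ((abs_alternating_le t₀ t₁ t₂ t₃).trans (le_of_eq ?_))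
  · unfold cubic
    ring
  · rw [hw]
    ring

lemma monotone_Tk (k : ℕ) : Monotone (Tk k) := fun _ _ h ↦
  sum_le_sum_of_subset_of_nonneg (Icc_subset_Icc_right (Nat.floor_le_floor h))
    fun _ _ _ ↦ Nat.cast_nonneg _

lemma Tk_one {x : ℝ} (hx : 0 ≤ x) : Tk 1 x = x - 1 / 2 - saw x := by
  rw [← natFloor_eq_sub_saw hx, Tk, sum_congr rfl (g := fun _ ↦ (1 : ℝ))]
  · simp
  · intro n hn
    have : n ≠ 0 := by have := (mem_Icc.1 hn).1; omega
    simp [dk, ArithmeticFunction.zeta_apply, this]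

lemma Tk_succ_eq_sum (k : ℕ) (x : ℝ) :
    Tk (k + 1) x = ∑ a ∈ Icc 1 ⌊x⌋₊, (dk k a : ℝ) * (⌊x⌋₊ / a : ℕ) := by
  have h := ArithmeticFunction.sum_Ioc_mul_zeta_eq_sum (ArithmeticFunction.zeta ^ k) ⌊x⌋₊
  rw [ArithmeticFunction.natCoe_nat, ← pow_succ] at h
  rw [Tk]
  simp only [dk]
  exact_mod_cast h

lemma sum_Tk_div (k : ℕ) (x : ℝ) (Z : ℕ) :
    ∑ m ∈ Icc 1 Z, Tk k (x / m) =
      ∑ a ∈ Icc 1 ⌊x⌋₊, (dk k a : ℝ) * (min Z (⌊x⌋₊ / a) : ℕ) := by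
  have h1 : ∀ m ∈ Icc 1 Z, Tk k (x / m) =
      ∑ a ∈ Icc 1 ⌊x⌋₊, if m ≤ ⌊x⌋₊ / a then (dk k a : ℝ) else 0 := by
    intro m hm
    have hm1 := (mem_Icc.1 hm).1
    rw [Tk, Nat.floor_div_natCast, ← sum_filter]
    refine sum_congr ?_ fun _ _ ↦ rfl
    ext a
    simp only [mem_filter, mem_Icc]
    constructor
    · rintro ⟨h, h'⟩
      refine ⟨⟨h, h'.trans (Nat.div_le_self _ _)⟩, ?_⟩
      rw [Nat.le_div_iff_mul_le h, mul_comm]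
      exact (Nat.le_div_iff_mul_le hm1).1 h'
    · rintro ⟨⟨h, -⟩, h'⟩
      refine ⟨h, ?_⟩
      rw [Nat.le_div_iff_mul_le hm1, mul_comm]
      exact (Nat.le_div_iff_mul_le h).1 h'
  rw [sum_congr rfl h1, sum_comm]
  refine sum_congr rfl fun a _ ↦ ?_
  rw [← sum_filter]
  have : {m ∈ Icc 1 Z | m ≤ ⌊x⌋₊ / a} = Icc 1 (min Z (⌊x⌋₊ / a)) := by
    ext m
    simp only [mem_filter, mem_Icc, le_min_iff]
    tauto
  rw [this, sum_const, Nat.card_Icc, Nat.add_sub_cancel, nsmul_eq_mul, mul_comm]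

/-- The Dirichlet hyperbola method for `Tk (k + 1) x`, split at `y`. -/
lemma Tk_succ_hyperbola (k : ℕ) {x y : ℝ} (hy : 1 ≤ y) (hyx : y ≤ x) :
    Tk (k + 1) x = ∑ m ∈ Icc 1 ⌊x / y⌋₊, Tk k (x / m) +
      ∑ n ∈ Icc 1 ⌊y⌋₊, ((⌊x / n⌋₊ : ℝ) - ⌊x / y⌋₊) * dk k n := by
  have hy0 : 0 < y := zero_lt_one.trans_le hy
  have hx0 : 0 < x := hy0.trans_le hyx
  have hsub : Icc 1 ⌊y⌋₊ ⊆ Icc 1 ⌊x⌋₊ := Icc_subset_Icc_right (Nat.floor_le_floor hyx)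
  have h2 : ∑ n ∈ Icc 1 ⌊y⌋₊, ((⌊x / n⌋₊ : ℝ) - ⌊x / y⌋₊) * dk k n =
      ∑ a ∈ Icc 1 ⌊x⌋₊, ((⌊x⌋₊ / a : ℕ) - (min ⌊x / y⌋₊ (⌊x⌋₊ / a) : ℕ) : ℝ) * dk k a := by
    rw [← sum_subset hsub]
    · refine sum_congr rfl fun a ha ↦ ?_
      obtain ⟨h1, h2⟩ := mem_Icc.1 ha
      have ha0 : (0 : ℝ) < a := by exact_mod_cast h1
      have hay : (a : ℝ) ≤ y := (Nat.le_floor_iff hy0.le).1 h2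
      rw [Nat.floor_div_natCast, min_eq_left]
      rw [← Nat.floor_div_natCast]
      gcongr
    · intro a ha ha'
      obtain ⟨h1, h2⟩ := mem_Icc.1 ha
      have ha0 : (0 : ℝ) < a := by exact_mod_cast h1
      have hay : y ≤ a := by
        by_contra! h
        exact ha' (mem_Icc.2 ⟨h1, Nat.le_floor h.le⟩)
      rw [min_eq_right, sub_self, zero_mul]
      rw [← Nat.floor_div_natCast]
      gcongr
  rw [h2, sum_Tk_div, Tk_succ_eq_sum, ← sum_add_distrib]
  exact sum_congr rfl fun a _ ↦ by ring

lemma setIntegral_Ioi_eq_add {f : ℝ → ℝ} {a b : ℝ} (hab : a ≤ b) (hf : IntegrableOn f (Set.Ioi a)) :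
    ∫ t in Set.Ioi a, f t = (∫ t in Set.Ioc a b, f t) + ∫ t in Set.Ioi b, f t := by
  rw [← Set.Ioc_union_Ioi_eq_Ioi hab]
  exact setIntegral_union (Set.Ioc_disjoint_Ioi le_rfl) measurableSet_Ioi
    (hf.mono_set Set.Ioc_subset_Ioi_self) (hf.mono_set (Set.Ioi_subset_Ioi hab))

lemma integral_Ioi_one_div_sq {a : ℝ} (ha : 0 < a) :
    IntegrableOn (fun t : ℝ ↦ 1 / t ^ 2) (Set.Ioi a) ∧ ∫ t in Set.Ioi a, 1 / t ^ 2 = 1 / a := by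
  simpa [cubic] using integral_cubic_log_div_sq ha 1 0 0 0 (by simp) (by simp) (by simp) (by simp)

lemma mul_one_div_le_setIntegral {E : ℝ → ℝ} {a : ℝ} {s : Set ℝ} (hs : MeasurableSet s)
    (hsa : ∀ t ∈ s, a ≤ t) (ha : 1 ≤ a) (hE : MonotoneOn E (Set.Ici 1))
    (hi : IntegrableOn (fun t : ℝ ↦ 1 / t ^ 2) s) (hEi : IntegrableOn (fun t ↦ E t / t ^ 2) s) :
    E a * ∫ t in s, 1 / t ^ 2 ≤ ∫ t in s, E t / t ^ 2 := by
  rw [← integral_const_mul]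
  refine setIntegral_mono_on (hi.const_mul _) hEi hs fun t ht ↦ ?_
  rw [mul_one_div]
  have := hE ha (ha.trans (hsa t ht)) (hsa t ht)
  gcongr

lemma sum_div_le_mul_integral {E : ℝ → ℝ} (hE : MonotoneOn E (Set.Ici 1))
    (hE0 : ∀ t ∈ Set.Ici 1, 0 ≤ E t)
    (hEi : IntegrableOn (fun t ↦ E t / t ^ 2) (Set.Ioi 1)) {x y : ℝ} (hy : 1 ≤ y) (hyx : y ≤ x) :
    ∑ m ∈ Icc 1 ⌊x / y⌋₊, E (x / m) ≤ x * ∫ t in Set.Ioi y, E t / t ^ 2 := by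
  have hy0 : 0 < y := zero_lt_one.trans_le hy
  have hx0 : 0 < x := hy0.trans_le hyx
  have key : ∀ M : ℕ, 1 ≤ M → 1 ≤ x / M →
      ∑ m ∈ Icc 1 M, E (x / m) ≤ x * ∫ t in Set.Ioi (x / M), E t / t ^ 2 := by
    intro M hM
    induction M, hM using Nat.le_induction with
    | base =>
      intro h
      simp only [Icc_self, sum_singleton, Nat.cast_one, div_one] at h ⊢
      obtain ⟨hi, he⟩ := integral_Ioi_one_div_sq hx0
      have := mul_one_div_le_setIntegral measurableSet_Ioi (fun t ht ↦ le_of_lt ht) h hE hi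
        (hEi.mono_set (Set.Ioi_subset_Ioi h))
      rw [he, mul_one_div, div_le_iff₀ hx0] at this
      linarith
    | succ M hM ih =>
      intro h
      have hM0 : (0 : ℝ) < M := by exact_mod_cast hM
      have hle : x / (M + 1 : ℕ) ≤ x / M := by
        gcongr
        exact Nat.le_succ M
      have ih := ih (h.trans hle)
      have hpos : 0 < x / (M + 1 : ℕ) := zero_lt_one.trans_le h
      obtain ⟨hi, he⟩ := integral_Ioi_one_div_sq hpos
      obtain ⟨-, he'⟩ := integral_Ioi_one_div_sq (div_pos hx0 hM0)
      have hEi' := hEi.mono_set (Set.Ioi_subset_Ioi h)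
      have hb := mul_one_div_le_setIntegral (a := x / (M + 1 : ℕ)) measurableSet_Ioc
        (fun t ht ↦ le_of_lt ht.1) h hE
        (hi.mono_set (Set.Ioc_subset_Ioi_self : Set.Ioc _ (x / M) ⊆ _))
        (hEi'.mono_set Set.Ioc_subset_Ioi_self)
      have hs := setIntegral_Ioi_eq_add hle hi
      rw [he, he'] at hs
      rw [← sub_eq_iff_eq_add.2 hs] at hb
      rw [sum_Icc_succ_top (by omega), setIntegral_Ioi_eq_add hle hEi', mul_add]
      have hc : x * (E (x / (M + 1 : ℕ)) * (1 / (x / (M + 1 : ℕ)) - 1 / (x / M))) =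
          E (x / (M + 1 : ℕ)) := by
        push_cast
        field_simp
        ring
      have := mul_le_mul_of_nonneg_left hb hx0.le
      linarith
  have hM : 1 ≤ ⌊x / y⌋₊ := Nat.le_floor (by rw [Nat.cast_one]; exact (one_le_div hy0).2 hyx)
  have hM0 : (0 : ℝ) < ⌊x / y⌋₊ := by exact_mod_cast hM
  have hyM : y ≤ x / ⌊x / y⌋₊ := by
    rw [le_div_iff₀ hM0, mul_comm, ← le_div_iff₀ hy0]
    exact Nat.floor_le (div_pos hx0 hy0).le
  refine (key _ hM (hy.trans hyM)).trans ?_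
  refine mul_le_mul_of_nonneg_left ?_ hx0.le
  refine setIntegral_mono_set (hEi.mono_set (Set.Ioi_subset_Ioi hy)) ?_
    (Set.Ioi_subset_Ioi hyM).eventuallyLE
  refine (ae_restrict_iff' measurableSet_Ioi).2 (ae_of_all _ fun t ht ↦ ?_)
  have := hE0 t (hy.trans (le_of_lt ht))
  positivity

/-- If the error term in the asymptotic formula for `Tk k` is integrable against `t⁻²`, then
`∑ dk k n / n` has an asymptotic formula with a constant term. -/
lemma sum_one_div_mul_dk {k : ℕ} {p₀ p₁ p₂ p₃ : ℝ}
    (hi : IntegrableOn (fun t ↦ (Tk k t - t * cubic p₀ p₁ p₂ p₃ (log t)) / t ^ 2) (Set.Ioi 1))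
    {y : ℝ} (hy : 1 ≤ y) :
    ∑ n ∈ Icc 1 ⌊y⌋₊, 1 / (n : ℝ) * dk k n =
      Tk k y / y + cubicPrim p₀ p₁ p₂ p₃ (log y) +
        (∫ t in Set.Ioi 1, (Tk k t - t * cubic p₀ p₁ p₂ p₃ (log t)) / t ^ 2) -
        ∫ t in Set.Ioi y, (Tk k t - t * cubic p₀ p₁ p₂ p₃ (log t)) / t ^ 2 := by
  have hne {u : ℝ} (hu : u ∈ Set.Icc 1 y) : u ≠ 0 := (zero_lt_one.trans_le hu.1).ne'
  have hd : ∀ t ∈ Set.Icc 1 y, HasDerivAt (fun t : ℝ ↦ 1 / t) (-1 / t ^ 2) t := by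
    intro t ht
    simpa [neg_div] using hasDerivAt_inv (hne ht)
  have hc : ContinuousOn (fun t : ℝ ↦ -1 / t ^ 2) (Set.Icc 1 y) :=
    continuousOn_const.div (continuousOn_id.pow 2) fun t ht ↦ pow_ne_zero 2 (hne ht)
  have hA := sum_mul_eq_sub_integral (fun n ↦ (dk k n : ℝ)) hd hc
  have hcP : ContinuousOn (fun t ↦ cubic p₀ p₁ p₂ p₃ (log t) / t) (Set.Icc 1 y) :=
    ((continuous_cubic _ _ _ _).comp_continuousOn
      (continuousOn_log.mono fun t ht ↦ hne ht)).div continuousOn_id fun t ht ↦ hne ht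
  have hP : ∫ t in Set.Ioc 1 y, cubic p₀ p₁ p₂ p₃ (log t) / t = cubicPrim p₀ p₁ p₂ p₃ (log y) := by
    rw [← intervalIntegral.integral_of_le hy, intervalIntegral.integral_eq_sub_of_hasDerivAt
      (f := fun t ↦ cubicPrim p₀ p₁ p₂ p₃ (log t))]
    · simp [cubicPrim]
    · intro t ht
      rw [Set.uIcc_of_le hy] at ht
      simpa [div_eq_mul_inv] using! (hasDerivAt_cubicPrim p₀ p₁ p₂ p₃ _).comp t
        (hasDerivAt_log (hne ht))
    · exact hcP.intervalIntegrable_of_Icc hy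
  have hI : ∫ t in Set.Ioc 1 y, -1 / t ^ 2 * ∑ n ∈ Icc 1 ⌊t⌋₊, (dk k n : ℝ) =
      -((∫ t in Set.Ioc 1 y, cubic p₀ p₁ p₂ p₃ (log t) / t) +
        ∫ t in Set.Ioc 1 y, (Tk k t - t * cubic p₀ p₁ p₂ p₃ (log t)) / t ^ 2) := by
    rw [← integral_add (hcP.integrableOn_Icc.mono_set Set.Ioc_subset_Icc_self)
      (hi.mono_set Set.Ioc_subset_Ioi_self), ← integral_neg]
    refine setIntegral_congr_fun measurableSet_Ioc fun t ht ↦ ?_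
    have := hne (Set.Ioc_subset_Icc_self ht)
    simp only [Tk]
    field_simp
    ring
  rw [hA, hI, hP, setIntegral_Ioi_eq_add hy hi]
  simp only [Tk]
  ring

/-- The induction step: an asymptotic formula for `Tk k` with error `E` yields one for
`Tk (k + 1)`, with a parameter `y` to be optimised. -/
lemma exists_Tk_succ_bound {k : ℕ} {p₀ p₁ p₂ p₃ b₀ b₁ b₂ b₃ C₀ : ℝ} {E : ℝ → ℝ}
    (h₀ : |p₀| ≤ b₀) (h₁ : |p₁| ≤ b₁) (h₂ : |p₂| ≤ b₂) (h₃ : |p₃| ≤ b₃)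
    (hE : MonotoneOn E (Set.Ici 1)) (hEi : IntegrableOn (fun t ↦ E t / t ^ 2) (Set.Ioi 1))
    (hEC : ∫ t in Set.Ioi 1, E t / t ^ 2 ≤ C₀)
    (hT : ∀ t : ℝ, 1 ≤ t → |Tk k t - t * cubic p₀ p₁ p₂ p₃ (log t)| ≤ E t) :
    ∃ q₀ q₁ q₂ q₃ : ℝ, |q₀| ≤ C₀ + (b₀ + 2 * b₁ + 2 * b₂ + 2 * b₃) ∧
      |q₁ - p₀| ≤ b₁ + 2 * b₂ + 2 * b₃ ∧ |q₂ - p₁| ≤ b₂ + 2 * b₃ ∧ |q₃ - p₂| ≤ b₃ ∧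
      ∀ x y : ℝ, 1 ≤ y → y ≤ x →
        |Tk (k + 1) x - x * (cubic q₀ q₁ q₂ q₃ (log x) + p₃ * log x ^ 4 / 24)| ≤
          y * cubic (b₀ + 2 * b₁ + 2 * b₂ + 2 * b₃) (b₁ + 2 * b₂ + 2 * b₃) (b₂ + 2 * b₃) b₃
            (log y) + E y + 2 * x * ∫ t in Set.Ioi y, E t / t ^ 2 := by
  obtain ⟨g₀, g₁, g₂, g₃, hg₀, hg₁, hg₂, hg₃, hg⟩ := exists_sum_cubic_log_div h₀ h₁ h₂ h₃
  set D : ℝ → ℝ := fun t ↦ Tk k t - t * cubic p₀ p₁ p₂ p₃ (log t) with hD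
  have hE0 : ∀ t ∈ Set.Ici 1, 0 ≤ E t := fun t ht ↦ (abs_nonneg _).trans (hT t ht)
  have hDE : ∀ t ∈ Set.Ioi (1 : ℝ), ‖D t / t ^ 2‖ ≤ E t / t ^ 2 := by
    intro t ht
    rw [norm_div, Real.norm_of_nonneg (sq_nonneg t)]
    gcongr
    exact hT t (le_of_lt ht)
  have hDm : Measurable fun t ↦ D t / t ^ 2 := by
    have := (monotone_Tk k).measurable
    have := (continuous_cubic p₀ p₁ p₂ p₃).measurable
    fun_prop
  have hDi : IntegrableOn (fun t ↦ D t / t ^ 2) (Set.Ioi 1) :=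
    hEi.mono' hDm.aestronglyMeasurable
      ((ae_restrict_iff' measurableSet_Ioi).2 (ae_of_all _ hDE))
  have hDint : ∀ y : ℝ, 1 ≤ y →
      |∫ t in Set.Ioi y, D t / t ^ 2| ≤ ∫ t in Set.Ioi y, E t / t ^ 2 := fun y hy ↦
    norm_integral_le_of_norm_le (hEi.mono_set (Set.Ioi_subset_Ioi hy))
      ((ae_restrict_iff' measurableSet_Ioi).2
        (ae_of_all _ fun t ht ↦ hDE t (Set.Ioi_subset_Ioi hy ht)))
  have n₀ : 0 ≤ b₀ := (abs_nonneg _).trans h₀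
  have n₁ : 0 ≤ b₁ := (abs_nonneg _).trans h₁
  have n₂ : 0 ≤ b₂ := (abs_nonneg _).trans h₂
  have n₃ : 0 ≤ b₃ := (abs_nonneg _).trans h₃
  refine ⟨(∫ t in Set.Ioi 1, D t / t ^ 2) + g₀, p₀ + g₁, p₁ + g₂, p₂ + g₃,
    (abs_add_le _ _).trans (add_le_add ((hDint 1 le_rfl).trans hEC) hg₀),
    by simpa using hg₁, by simpa using hg₂, by simpa using hg₃, fun x y hy hyx ↦ ?_⟩
  have hy0 : 0 < y := zero_lt_one.trans_le hy
  have hx0 : 0 < x := hy0.trans_le hyx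
  have hz : 1 ≤ x / y := (one_le_div hy0).2 hyx
  have hL : 0 ≤ log y := log_nonneg hy
  set W := cubic (b₀ + 2 * b₁ + 2 * b₂ + 2 * b₃) (b₁ + 2 * b₂ + 2 * b₃) (b₂ + 2 * b₃) b₃ (log y)
    with hW
  set A := ∫ t in Set.Ioi y, E t / t ^ 2 with hA
  have hg := hg x (x / y) hz (div_le_self hx0.le hy)
  rw [div_div_cancel₀ hx0.ne', ← hW] at hg
  set M := ∑ m ∈ Icc 1 ⌊x / y⌋₊, cubic p₀ p₁ p₂ p₃ (log (x / m)) / m with hM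
  have e1 : ∑ m ∈ Icc 1 ⌊x / y⌋₊, Tk k (x / m) = ∑ m ∈ Icc 1 ⌊x / y⌋₊, D (x / m) + x * M := by
    rw [hM, mul_sum, ← sum_add_distrib]
    refine sum_congr rfl fun m _ ↦ ?_
    simp only [hD]
    ring
  have e2 : ∑ n ∈ Icc 1 ⌊y⌋₊, ((⌊x / n⌋₊ : ℝ) - ⌊x / y⌋₊) * dk k n =
      x * ∑ n ∈ Icc 1 ⌊y⌋₊, 1 / (n : ℝ) * dk k n - x / y * Tk k y + saw (x / y) * Tk k y -
        ∑ n ∈ Icc 1 ⌊y⌋₊, saw (x / n) * dk k n := by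
    rw [Tk, mul_sum, mul_sum, mul_sum, ← sum_sub_distrib, ← sum_add_distrib, ← sum_sub_distrib]
    refine sum_congr rfl fun n _ ↦ ?_
    rw [natFloor_eq_sub_saw (by positivity), natFloor_eq_sub_saw (by positivity)]
    ring
  have hS : _ = _ + (∫ t in Set.Ioi 1, D t / t ^ 2) - ∫ t in Set.Ioi y, D t / t ^ 2 :=
    sum_one_div_mul_dk hDi hy
  have hDy : D y = Tk k y - y * cubic p₀ p₁ p₂ p₃ (log y) := rfl
  rw [Tk_succ_hyperbola k hy hyx, e1, e2, hS]
  have b1 : |∑ m ∈ Icc 1 ⌊x / y⌋₊, D (x / m)| ≤ x * A := by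
    refine (abs_sum_le_sum_abs _ _).trans ((sum_le_sum fun m hm ↦ hT _ ?_).trans
      (sum_div_le_mul_integral hE hE0 hEi hy hyx))
    obtain ⟨hm1, hm2⟩ := mem_Icc.1 hm
    have hm0 : (0 : ℝ) < m := by exact_mod_cast hm1
    have : (m : ℝ) ≤ x / y := (Nat.le_floor_iff (by positivity)).1 hm2
    rw [le_div_iff₀ hy0] at this
    rw [one_le_div hm0]
    nlinarith
  have b2 : |∑ n ∈ Icc 1 ⌊y⌋₊, saw (x / n) * dk k n| ≤ 1 / 2 * (y * W + E y) := by
    have : |∑ n ∈ Icc 1 ⌊y⌋₊, saw (x / n) * dk k n| ≤ 1 / 2 * Tk k y := by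
      rw [Tk, mul_sum]
      refine (abs_sum_le_sum_abs _ _).trans (sum_le_sum fun n _ ↦ ?_)
      rw [abs_mul, Nat.abs_cast]
      gcongr
      exact abs_saw_le _
    have h1 := (abs_le.1 (hT y hy)).2
    have h2 := (abs_le.1 (abs_cubic_le hL h₀ h₁ h₂ h₃)).2
    have h3 : cubic b₀ b₁ b₂ b₃ (log y) ≤ W := by
      rw [hW]
      unfold cubic
      gcongr <;> linarith
    have := mul_le_mul_of_nonneg_left (h2.trans h3) hy0.le
    linarith
  have b3 : |saw (x / y) * D y| ≤ 1 / 2 * E y := by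
    rw [abs_mul]
    exact mul_le_mul (abs_saw_le _) (hT y hy) (abs_nonneg _) (by norm_num)
  have b4 : |x * ∫ t in Set.Ioi y, D t / t ^ 2| ≤ x * A := by
    rw [abs_mul, abs_of_pos hx0]
    exact mul_le_mul_of_nonneg_left (hDint y hy) hx0.le
  have b5 := mul_le_mul_of_nonneg_left hg hx0.le
  rw [← abs_of_pos hx0, ← abs_mul, abs_of_pos hx0] at b5
  have hW' : x * (W * (1 / (x / y) / 2)) = 1 / 2 * (y * W) := by
    field_simp
  rw [hW'] at b5
  refine (le_of_eq (congrArg _ ?_)).trans ((abs_add_le _ _).trans ((add_le_add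
    ((abs_alternating_le b1 b4 b5 b2)) b3).trans (le_of_eq ?_)))
  · rw [hDy]
    generalize ∑ m ∈ Icc 1 ⌊x / y⌋₊, D (x / m) = s₁
    generalize ∑ n ∈ Icc 1 ⌊y⌋₊, saw (x / n) * (dk k n : ℝ) = s₂
    unfold cubic cubicPrim
    field_simp
    ring
  · ring

/-- The shape of the error terms: `c t ^ (1 - σ) (log t + 8) ^ β`. -/
noncomputable def errTerm (c σ β t : ℝ) : ℝ := c * t ^ (1 - σ) * (log t + 8) ^ β

lemma log_add_eight_pos {t : ℝ} (ht : 1 ≤ t) : 0 < log t + 8 := by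
  linarith [log_nonneg ht]

lemma monotoneOn_errTerm {c σ β : ℝ} (hc : 0 ≤ c) (hσ : σ ≤ 1) (hβ : 0 ≤ β) :
    MonotoneOn (errTerm c σ β) (Set.Ici 1) := by
  intro s hs t ht hst
  have hs0 : 0 < s := zero_lt_one.trans_le hs
  have := log_add_eight_pos hs
  have : 0 ≤ 1 - σ := sub_nonneg.2 hσ
  have ht0 : 0 < t := hs0.trans_le hst
  unfold errTerm
  gcongr

lemma log_add_eight_rpow_le {β δ y t : ℝ} (hβ : 0 ≤ β) (hy : 1 ≤ y) (hδ : β ≤ δ * (log y + 8))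
    (hyt : y ≤ t) : (log t + 8) ^ β ≤ (log y + 8) ^ β * (t / y) ^ δ := by
  have hy0 : 0 < y := zero_lt_one.trans_le hy
  have ht0 : 0 < t := hy0.trans_le hyt
  have hl := log_add_eight_pos hy
  have hL : 0 ≤ log (t / y) := log_nonneg ((one_le_div hy0).2 hyt)
  have h1 : log t + 8 ≤ (log y + 8) * exp (log (t / y) / (log y + 8)) := by
    have := add_one_le_exp (log (t / y) / (log y + 8))
    calc log t + 8 = (log y + 8) * (log (t / y) / (log y + 8) + 1) := by
          rw [mul_add, mul_div_cancel₀ _ hl.ne', log_div ht0.ne' hy0.ne']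
          ring
      _ ≤ _ := by gcongr
  have h2 : exp (log (t / y) / (log y + 8)) ^ β ≤ (t / y) ^ δ := by
    rw [← exp_mul, rpow_def_of_pos (div_pos ht0 hy0), exp_le_exp, div_mul_eq_mul_div,
      div_le_iff₀ hl, mul_assoc]
    gcongr
  have := log_add_eight_pos (hy.trans hyt)
  calc (log t + 8) ^ β ≤ ((log y + 8) * exp (log (t / y) / (log y + 8))) ^ β := by gcongr
    _ = (log y + 8) ^ β * exp (log (t / y) / (log y + 8)) ^ β :=
        mul_rpow hl.le (exp_pos _).le
    _ ≤ _ := by gcongr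

lemma integral_errTerm {c σ β δ y : ℝ} (hc : 0 ≤ c) (hβ : 0 ≤ β) (hy : 1 ≤ y) (hδσ : δ < σ)
    (hδ : β ≤ δ * (log y + 8)) :
    IntegrableOn (fun t ↦ errTerm c σ β t / t ^ 2) (Set.Ioi y) ∧
      ∫ t in Set.Ioi y, errTerm c σ β t / t ^ 2 ≤
        c / (σ - δ) * y ^ (-σ) * (log y + 8) ^ β := by
  have hy0 : 0 < y := zero_lt_one.trans_le hy
  have hl := log_add_eight_pos hy
  have he : -1 - (σ - δ) < -1 := by linarith
  have hg := (integrableOn_Ioi_rpow_of_lt he hy0).const_mul (c * (log y + 8) ^ β * y ^ (-δ))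
  have hle : ∀ t ∈ Set.Ioi y, errTerm c σ β t / t ^ 2 ≤
      c * (log y + 8) ^ β * y ^ (-δ) * t ^ (-1 - (σ - δ)) := by
    intro t ht
    have ht0 : 0 < t := hy0.trans ht
    have h := log_add_eight_rpow_le hβ hy hδ (le_of_lt ht)
    have e : t ^ (1 - σ) * t ^ δ / t ^ 2 = t ^ (-1 - (σ - δ)) := by
      rw [← rpow_add ht0, ← rpow_natCast, ← rpow_sub ht0]
      congr 1
      push_cast
      ring
    calc errTerm c σ β t / t ^ 2
        ≤ c * t ^ (1 - σ) * ((log y + 8) ^ β * (t / y) ^ δ) / t ^ 2 := by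
          unfold errTerm
          gcongr
      _ = _ := by
          rw [← e, div_rpow ht0.le hy0.le, rpow_neg hy0.le]
          ring
  have hnn : ∀ t ∈ Set.Ioi y, 0 ≤ errTerm c σ β t / t ^ 2 := by
    intro t ht
    have ht0 : 0 < t := hy0.trans ht
    have := log_add_eight_pos (hy.trans (le_of_lt ht))
    unfold errTerm
    positivity
  have hi : IntegrableOn (fun t ↦ errTerm c σ β t / t ^ 2) (Set.Ioi y) := by
    have hm : Measurable fun t ↦ errTerm c σ β t / t ^ 2 := by
      unfold errTerm
      fun_prop
    refine hg.mono' hm.aestronglyMeasurable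
      ((ae_restrict_iff' measurableSet_Ioi).2 (ae_of_all _ fun t ht ↦ ?_))
    rw [Real.norm_of_nonneg (hnn t ht)]
    exact hle t ht
  refine ⟨hi, (setIntegral_mono_on hi hg measurableSet_Ioi hle).trans (le_of_eq ?_)⟩
  rw [integral_const_mul, integral_Ioi_rpow_of_lt he hy0]
  have e : y ^ (-1 - (σ - δ) + 1) = y ^ (-σ) * y ^ δ := by
    rw [← rpow_add hy0]
    congr 1
    ring
  have : σ - δ ≠ 0 := (sub_pos.2 hδσ).ne'
  have h1 : -1 - (σ - δ) + 1 = -(σ - δ) := by ring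
  have := (rpow_pos_of_pos hy0 δ).ne'
  rw [e, h1, rpow_neg hy0.le δ]
  field_simp

/-- The bound obtained from the choice `y = lam x ^ (1 - σ') (log x + 8) ^ (-b)`. -/
lemma step_error_le {x y lam b σ σ' β β' δ c c' m W κ I : ℝ} (hx : 1 ≤ x)
    (hy : y = lam * x ^ (1 - σ') * (log x + 8) ^ (-b)) (hlam : 0 < lam) (hy1 : 1 ≤ y)
    (hyx : y ≤ x) (hc : 0 ≤ c) (hβ : 0 ≤ β) (hδσ : δ < σ) (h1 : (1 - σ') * (1 + σ) = 1)
    (h2 : β' = m - b) (h3 : β' = β + b * σ) (hW : W ≤ κ * (log x + 8) ^ m)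
    (hc' : lam * κ + c * lam ^ (-σ) * (1 + 2 / (σ - δ)) ≤ c')
    (hI : I ≤ c / (σ - δ) * y ^ (-σ) * (log y + 8) ^ β) :
    y * W + errTerm c σ β y + 2 * x * I ≤ errTerm c' σ' β' x := by
  have hx0 : 0 < x := zero_lt_one.trans_le hx
  have hy0 : 0 < y := zero_lt_one.trans_le hy1
  have hl := log_add_eight_pos hx
  have hly := log_add_eight_pos hy1
  have hs : 0 < σ - δ := sub_pos.2 hδσ
  set G := x ^ (1 - σ') * (log x + 8) ^ β' with hG
  have hG0 : 0 ≤ G := by positivity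
  have t1 : y * W ≤ lam * κ * G := by
    refine (mul_le_mul_of_nonneg_left hW hy0.le).trans (le_of_eq ?_)
    have : (log x + 8) ^ (-b) * (log x + 8) ^ m = (log x + 8) ^ β' := by
      rw [← rpow_add hl, h2]
      congr 1
      ring
    rw [hG, ← this, hy]
    ring
  have t2 : x * (y ^ (-σ) * (log y + 8) ^ β) ≤ lam ^ (-σ) * G := by
    have hle : (log y + 8) ^ β ≤ (log x + 8) ^ β := by gcongr
    have e1 : y ^ (-σ) = lam ^ (-σ) * x ^ ((1 - σ') * -σ) * (log x + 8) ^ (-b * -σ) := by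
      rw [hy, mul_rpow (by positivity) (by positivity), mul_rpow (by positivity) (by positivity),
        ← rpow_mul hx0.le, ← rpow_mul hl.le]
    have e2 : x * x ^ ((1 - σ') * -σ) = x ^ (1 - σ') := by
      nth_rewrite 1 [← rpow_one x]
      rw [← rpow_add hx0]
      congr 1
      linarith
    have e3 : (log x + 8) ^ (-b * -σ) * (log x + 8) ^ β = (log x + 8) ^ β' := by
      rw [← rpow_add hl, h3]
      congr 1
      ring
    calc x * (y ^ (-σ) * (log y + 8) ^ β) ≤ x * (y ^ (-σ) * (log x + 8) ^ β) := by gcongr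
      _ = _ := by
        rw [hG, ← e2, ← e3, e1]
        ring
  have t3 : errTerm c σ β y ≤ c * (lam ^ (-σ) * G) := by
    have e : y ^ (1 - σ) = y * y ^ (-σ) := by
      rw [sub_eq_add_neg, rpow_add hy0, rpow_one]
    rw [errTerm, e, mul_assoc, mul_assoc]
    refine mul_le_mul_of_nonneg_left (le_trans ?_ t2) hc
    gcongr
  have t4 : 2 * x * I ≤ 2 * (c / (σ - δ)) * (lam ^ (-σ) * G) := by
    calc 2 * x * I ≤ 2 * x * (c / (σ - δ) * y ^ (-σ) * (log y + 8) ^ β) := by gcongr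
      _ = 2 * (c / (σ - δ)) * (x * (y ^ (-σ) * (log y + 8) ^ β)) := by ring
      _ ≤ _ := by gcongr
  calc y * W + errTerm c σ β y + 2 * x * I
      ≤ (lam * κ + c * lam ^ (-σ) * (1 + 2 / (σ - δ))) * G := by
        refine (add_le_add (add_le_add t1 t3) t4).trans (le_of_eq ?_)
        ring
    _ ≤ c' * G := by gcongr
    _ = _ := by rw [errTerm, mul_assoc]

lemma exists_Tk_succ_errTerm {k : ℕ} {p₀ p₁ p₂ p₃ b₀ b₁ b₂ b₃ c σ β δ C₀ : ℝ}
    (h₀ : |p₀| ≤ b₀) (h₁ : |p₁| ≤ b₁) (h₂ : |p₂| ≤ b₂) (h₃ : |p₃| ≤ b₃)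
    (hc : 0 ≤ c) (hσ : σ ≤ 1) (hβ : 0 ≤ β) (hδσ : δ < σ) (hδ : β ≤ δ * 8)
    (hC : c / (σ - δ) * 8 ^ β ≤ C₀)
    (hT : ∀ t : ℝ, 1 ≤ t → |Tk k t - t * cubic p₀ p₁ p₂ p₃ (log t)| ≤ errTerm c σ β t) :
    ∃ q₀ q₁ q₂ q₃ : ℝ, |q₀| ≤ C₀ + (b₀ + 2 * b₁ + 2 * b₂ + 2 * b₃) ∧
      |q₁ - p₀| ≤ b₁ + 2 * b₂ + 2 * b₃ ∧ |q₂ - p₁| ≤ b₂ + 2 * b₃ ∧ |q₃ - p₂| ≤ b₃ ∧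
      ∀ x y : ℝ, 1 ≤ y → y ≤ x →
        |Tk (k + 1) x - x * (cubic q₀ q₁ q₂ q₃ (log x) + p₃ * log x ^ 4 / 24)| ≤
          y * cubic (b₀ + 2 * b₁ + 2 * b₂ + 2 * b₃) (b₁ + 2 * b₂ + 2 * b₃) (b₂ + 2 * b₃) b₃
            (log y) + errTerm c σ β y + 2 * x * ∫ t in Set.Ioi y, errTerm c σ β t / t ^ 2 := by
  obtain ⟨hi, he⟩ := integral_errTerm hc hβ le_rfl hδσ (by simpa using hδ)
  refine exists_Tk_succ_bound h₀ h₁ h₂ h₃ (monotoneOn_errTerm hc hσ hβ) hi (he.trans ?_) hT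
  simpa using hC

lemma one_le_param_and_le {x a b : ℝ} (hx : 1 ≤ x) (ha : a ≤ 1) (hb : 0 ≤ b) (hab : b ≤ a * 8) :
    1 ≤ 8 ^ b * x ^ a * (log x + 8) ^ (-b) ∧ 8 ^ b * x ^ a * (log x + 8) ^ (-b) ≤ x := by
  have hl := log_add_eight_pos hx
  have hlb := rpow_pos_of_pos hl b
  rw [rpow_neg hl.le, ← div_eq_mul_inv, one_le_div hlb, div_le_iff₀ hlb, mul_comm x]
  constructor
  · simpa using log_add_eight_rpow_le hb le_rfl (by simpa using hab) hx
  · have h1 : x ^ a ≤ x := by simpa using rpow_le_rpow_of_exponent_le hx ha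
    have h2 : (8 : ℝ) ≤ log x + 8 := by linarith [log_nonneg hx]
    gcongr

lemma Tk_one_bound {t : ℝ} (ht : 1 ≤ t) :
    |Tk 1 t - t * cubic 1 0 0 0 (log t)| ≤ errTerm 1 1 0 t := by
  rw [Tk_one (by linarith)]
  have := abs_le.1 (abs_saw_le t)
  simp only [cubic, errTerm, sub_self, rpow_zero]
  rw [abs_le]
  constructor <;> linarith [this.1, this.2]

lemma exists_Tk_two_bound : ∃ q₀ : ℝ, |q₀| ≤ 2 ∧
    ∀ t : ℝ, 1 ≤ t → |Tk 2 t - t * cubic q₀ 1 0 0 (log t)| ≤ errTerm 4 (1 / 2) 0 t := by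
  obtain ⟨q₀, q₁, q₂, q₃, h₀, h₁, h₂, h₃, h⟩ := exists_Tk_succ_errTerm (b₀ := 1) (b₁ := 0)
    (b₂ := 0) (b₃ := 0) (δ := 0) (C₀ := 1) (by simp) (by simp) (by simp) (by simp) zero_le_one
    le_rfl le_rfl zero_lt_one (by simp) (by simp) @Tk_one_bound
  norm_num [sub_eq_zero] at h₀ h₁ h₂ h₃ h
  subst h₁ h₂ h₃
  refine ⟨q₀, h₀, fun x hx ↦ ?_⟩
  obtain ⟨hy, hyx⟩ := one_le_param_and_le hx (a := 1 - 1 / 2) (b := 0) (by norm_num) le_rfl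
    (by norm_num)
  refine (h x _ hy hyx).trans (step_error_le (δ := 0) (m := 0) (κ := 1) hx rfl (by norm_num) hy hyx
    zero_le_one le_rfl zero_lt_one (by norm_num) (by norm_num) (by norm_num) ?_ ?_
    (integral_errTerm zero_le_one le_rfl hy zero_lt_one (by simp)).2)
  · simp [cubic]
  · norm_num

lemma exists_Tk_three_bound : ∃ q₀ q₁ : ℝ, |q₀| ≤ 12 ∧ |q₁| ≤ 3 ∧
    ∀ t : ℝ, 1 ≤ t → |Tk 3 t - t * cubic q₀ q₁ 1 0 (log t)| ≤ errTerm 14 (1 / 3) (1 / 3) t := by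
  obtain ⟨p₀, hp₀, hp⟩ := exists_Tk_two_bound
  obtain ⟨q₀, q₁, q₂, q₃, h₀, h₁, h₂, h₃, h⟩ := exists_Tk_succ_errTerm (b₀ := 2) (b₁ := 1)
    (b₂ := 0) (b₃ := 0) (δ := 0) (C₀ := 8) hp₀ (by simp) (by simp) (by simp) (by norm_num)
    (by norm_num) le_rfl (by norm_num) (by simp) (by norm_num) hp
  norm_num [sub_eq_zero] at h₀ h₁ h₂ h₃ h
  subst h₂ h₃
  refine ⟨q₀, q₁, h₀, ?_, fun x hx ↦ ?_⟩
  · rw [abs_le] at *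
    constructor <;> linarith [h₁.1, h₁.2, hp₀.1, hp₀.2]
  obtain ⟨hy, hyx⟩ := one_le_param_and_le hx (a := 1 - 1 / 3) (b := 2 / 3) (by norm_num)
    (by norm_num) (by norm_num)
  have hly := log_le_log (zero_lt_one.trans_le hy) hyx
  refine (h x _ hy hyx).trans (step_error_le (δ := 0) (m := 1) (κ := 1) hx rfl (by norm_num) hy hyx
    (by norm_num) le_rfl (by norm_num) (by norm_num) (by norm_num) (by norm_num) ?_ ?_
    (integral_errTerm (by norm_num) le_rfl hy (by norm_num) (by simp)).2)
  · simp only [cubic, rpow_one]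
    linarith
  · have e1 : (8 : ℝ) ^ (2 / 3 : ℝ) = 2 ^ (2 : ℝ) := by
      rw [show (8 : ℝ) = 2 ^ (3 : ℝ) by norm_num, ← rpow_mul (by norm_num)]
      norm_num
    have e2 : ((2 : ℝ) ^ (2 : ℝ)) ^ (-(1 / 2) : ℝ) = 1 / 2 := by
      rw [← rpow_mul (by norm_num)]
      norm_num [rpow_neg_one]
    rw [e1, e2]
    norm_num

lemma rpow_div_le {a b : ℝ} (ha : 0 ≤ a) (hb : 0 ≤ b) {m n : ℕ} (hn : n ≠ 0) (h : a ^ m ≤ b ^ n) :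
    a ^ (m / n : ℝ) ≤ b := by
  rw [div_eq_mul_inv, rpow_mul ha, rpow_natCast]
  calc (a ^ m) ^ (n : ℝ)⁻¹ ≤ (b ^ n) ^ (n : ℝ)⁻¹ := by gcongr
    _ = b := pow_rpow_inv_natCast hb hn

lemma exists_Tk_four_bound : ∃ q₀ q₁ q₂ : ℝ, |q₀| ≤ 116 ∧ |q₁| ≤ 17 ∧ |q₂| ≤ 4 ∧
    ∀ t : ℝ, 1 ≤ t → |Tk 4 t - t * cubic q₀ q₁ q₂ 1 (log t)| ≤ errTerm 54 (1 / 4) (3 / 4) t := by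
  obtain ⟨p₀, p₁, hp₀, hp₁, hp⟩ := exists_Tk_three_bound
  have e8 : (8 : ℝ) ^ (1 / 3 : ℝ) ≤ 2 := by
    simpa using rpow_div_le (a := 8) (b := 2) (m := 1) (n := 3) (by simp) (by simp) (by simp)
      (by norm_num)
  obtain ⟨q₀, q₁, q₂, q₃, h₀, h₁, h₂, h₃, h⟩ := exists_Tk_succ_errTerm (b₀ := 12) (b₁ := 3)
    (b₂ := 1) (b₃ := 0) (δ := 1 / 24) (C₀ := 96) hp₀ hp₁ (by simp) (by simp) (by norm_num)
    (by norm_num) (by norm_num) (by norm_num) (by norm_num) (by linarith) hp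
  norm_num [sub_eq_zero] at h₀ h₁ h₂ h₃ h
  subst h₃
  refine ⟨q₀, q₁, q₂, h₀, ?_, ?_, fun x hx ↦ ?_⟩
  · rw [abs_le] at *
    constructor <;> linarith [h₁.1, h₁.2, hp₀.1, hp₀.2]
  · rw [abs_le] at *
    constructor <;> linarith [h₂.1, h₂.2, hp₁.1, hp₁.2]
  obtain ⟨hy, hyx⟩ := one_le_param_and_le hx (a := 1 - 1 / 4) (b := 5 / 4) (by norm_num)
    (by norm_num) (by norm_num)
  have hly := log_le_log (zero_lt_one.trans_le hy) hyx
  have hL := log_nonneg hy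
  refine (h x _ hy hyx).trans (step_error_le (δ := 1 / 24) (m := 2) (κ := 1 / 2) hx rfl
    (by positivity) hy hyx (by norm_num) (by norm_num) (by norm_num) (by norm_num) (by norm_num)
    (by norm_num) ?_ ?_
    (integral_errTerm (by norm_num) (by norm_num) hy (by norm_num) (by linarith)).2)
  · generalize log (8 ^ (5 / 4 : ℝ) * x ^ (1 - 1 / 4 : ℝ) * (log x + 8) ^ (-(5 / 4) : ℝ)) = L at *
    rw [rpow_two]
    have : (L + 8) ^ 2 ≤ (log x + 8) ^ 2 := by gcongr
    unfold cubic
    nlinarith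
  · have e1 : (8 : ℝ) ^ (5 / 4 : ℝ) ≤ 13.5 := by
      simpa using rpow_div_le (a := 8) (b := 13.5) (m := 5) (n := 4) (by simp) (by norm_num)
        (by simp) (by norm_num)
    have e2 : ((8 : ℝ) ^ (5 / 4 : ℝ)) ^ (-(1 / 3) : ℝ) ≤ 0.421 := by
      have := rpow_div_le (a := 8⁻¹) (b := 0.421) (m := 5) (n := 12) (by simp) (by norm_num)
        (by simp) (by norm_num)
      rw [inv_rpow (by norm_num), ← rpow_neg (by norm_num)] at this
      rw [← rpow_mul (by norm_num)]
      norm_num at this ⊢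
      exact this
    norm_num at e1 e2 ⊢
    linarith

/-- The choice of parameter in the last step is admissible. -/
lemma param_bounds {x : ℝ} (hx : exp 57 ≤ x) :
    32 ≤ log (256 * x ^ (1 - 1 / 5 : ℝ) * (log x + 8) ^ (-(9 / 5) : ℝ)) ∧
      256 * x ^ (1 - 1 / 5 : ℝ) * (log x + 8) ^ (-(9 / 5) : ℝ) ≤ x := by
  have hx0 : 0 < x := (exp_pos _).trans_le hx
  have hX : 57 ≤ log x := (le_log_iff_exp_le hx0).2 hx
  have hl : 0 < log x + 8 := by linarith
  have h2 := log_two_gt_d9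
  have h2' := log_two_lt_d9
  have h256 : log 256 = 8 * log 2 := by
    rw [show (256 : ℝ) = 2 ^ 8 by norm_num, log_pow]
    norm_num
  have hy0 : 0 < 256 * x ^ (1 - 1 / 5 : ℝ) * (log x + 8) ^ (-(9 / 5) : ℝ) := by positivity
  have hlog : log (256 * x ^ (1 - 1 / 5 : ℝ) * (log x + 8) ^ (-(9 / 5) : ℝ)) =
      8 * log 2 + 4 / 5 * log x - 9 / 5 * log (log x + 8) := by
    rw [log_mul (by positivity) (by positivity), log_mul (by positivity) (by positivity),
      log_rpow hx0, log_rpow hl, h256]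
    ring
  have hll : log (log x + 8) ≤ 4 * log 2 + (log x + 8) / 16 - 1 := by
    have := log_le_sub_one_of_pos (div_pos hl (by norm_num : (0 : ℝ) < 16))
    rw [log_div hl.ne' (by norm_num), show (16 : ℝ) = 2 ^ 4 by norm_num, log_pow] at this
    norm_num at this
    linarith
  have hll0 : 0 ≤ log (log x + 8) := log_nonneg (by linarith)
  constructor
  · rw [hlog]
    linarith
  · rw [← log_le_log_iff hy0 hx0, hlog]
    linarith

lemma exists_Tk_five_bound : ∃ q₀ q₁ q₂ q₃ : ℝ, ∀ x : ℝ, exp 57 ≤ x →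
    |Tk 5 x - x * (cubic q₀ q₁ q₂ q₃ (log x) + log x ^ 4 / 24)| ≤
      errTerm 173 (1 / 5) (6 / 5) x := by
  obtain ⟨p₀, p₁, p₂, hp₀, hp₁, hp₂, hp⟩ := exists_Tk_four_bound
  obtain ⟨q₀, q₁, q₂, q₃, -, -, -, -, h⟩ := exists_Tk_succ_errTerm (b₃ := 1) (δ := 3 / 32)
    hp₀ hp₁ hp₂ (by simp) (by norm_num) (by norm_num) (by norm_num) (by norm_num) (by norm_num)
    le_rfl hp
  norm_num at h
  refine ⟨q₀, q₁, q₂, q₃, fun x hx ↦ ?_⟩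
  obtain ⟨hL, hyx⟩ := param_bounds hx
  have hx0 : 0 < x := (exp_pos _).trans_le hx
  have hX : 57 ≤ log x := (le_log_iff_exp_le hx0).2 hx
  have hx1 : 1 ≤ x := (one_le_exp (by norm_num)).trans hx
  have hl := log_add_eight_pos hx1
  have hy0 : 0 < 256 * x ^ (1 - 1 / 5 : ℝ) * (log x + 8) ^ (-(9 / 5) : ℝ) := by positivity
  have hy := one_le_exp (by norm_num : (0 : ℝ) ≤ 32) |>.trans ((le_log_iff_exp_le hy0).1 hL)
  have hly := log_le_log hy0 hyx
  refine (h x _ hy hyx).trans (step_error_le (δ := 3 / 160) (m := 3) (κ := 1 / 6) hx1 rfl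
    (by norm_num) hy hyx (by norm_num) (by norm_num) (by norm_num) (by norm_num) (by norm_num)
    (by norm_num) ?_ ?_
    (integral_errTerm (by norm_num) (by norm_num) hy (by norm_num) (by linarith)).2)
  · generalize log (256 * x ^ (1 - 1 / 5 : ℝ) * (log x + 8) ^ (-(9 / 5) : ℝ)) = L at *
    have h3 : (log x + 8) ^ (3 : ℝ) = (log x + 8) ^ 3 := by norm_cast
    rw [h3]
    have : (L + 8) ^ 3 ≤ (log x + 8) ^ 3 := by gcongr
    unfold cubic
    nlinarith
  · have e : (256 : ℝ) ^ (-(1 / 4) : ℝ) = 1 / 4 := by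
      rw [show (256 : ℝ) = 4 ^ (4 : ℝ) by norm_num, ← rpow_mul (by norm_num)]
      norm_num [rpow_neg_one]
    rw [e]
    norm_num

lemma errTerm_five_lt {x : ℝ} (hx : exp 57 ≤ x) :
    errTerm 173 (1 / 5) (6 / 5) x < 219.057 * x ^ ((4 : ℝ) / 5) * log x ^ ((6 : ℝ) / 5) := by
  have hx0 : 0 < x := (exp_pos _).trans_le hx
  have hX : 57 ≤ log x := (le_log_iff_exp_le hx0).2 hx
  have hX0 : 0 < log x := by linarith
  have hc : (65 / 57 : ℝ) ^ (6 / 5 : ℝ) ≤ 1.2 := by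
    simpa using rpow_div_le (a := 65 / 57) (b := 1.2) (m := 6) (n := 5) (by norm_num)
      (by norm_num) (by simp) (by norm_num)
  have h1 : (log x + 8) ^ (6 / 5 : ℝ) ≤ 1.2 * log x ^ (6 / 5 : ℝ) := by
    calc (log x + 8) ^ (6 / 5 : ℝ) ≤ (65 / 57 * log x) ^ (6 / 5 : ℝ) := by
          gcongr
          linarith
      _ = (65 / 57 : ℝ) ^ (6 / 5 : ℝ) * log x ^ (6 / 5 : ℝ) := mul_rpow (by norm_num) hX0.le
      _ ≤ _ := by gcongr
  have he : (1 - 1 / 5 : ℝ) = 4 / 5 := by norm_num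
  have hpos : 0 < x ^ (4 / 5 : ℝ) * log x ^ (6 / 5 : ℝ) := by positivity
  rw [errTerm, he]
  calc 173 * x ^ (4 / 5 : ℝ) * (log x + 8) ^ (6 / 5 : ℝ)
      ≤ 173 * x ^ (4 / 5 : ℝ) * (1.2 * log x ^ (6 / 5 : ℝ)) := by gcongr
    _ < _ := by linarith

theorem stmt_4 :
    ∃ P : Polynomial ℝ, P.natDegree ≤ 4 ∧ P.coeff 4 = 1 / 24 ∧
      ∀ x : ℝ, Real.exp 57 ≤ x →
        |Tk 5 x - x * P.eval (Real.log x)|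
          < 219.057 * x ^ ((4 : ℝ) / 5) * Real.log x ^ ((6 : ℝ) / 5) := by
  obtain ⟨q₀, q₁, q₂, q₃, h⟩ := exists_Tk_five_bound
  refine ⟨.C (1 / 24) * .X ^ 4 + .C (q₃ / 6) * .X ^ 3 + .C (q₂ / 2) * .X ^ 2 + .C q₁ * .X + .C q₀,
    by compute_degree, by compute_degree!, fun x hx ↦ ?_⟩
  refine (le_of_eq (congrArg _ ?_)).trans_lt ((h x hx).trans_lt (errTerm_five_lt hx))
  simp only [Polynomial.eval_add, Polynomial.eval_mul, Polynomial.eval_C, Polynomial.eval_pow,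
    Polynomial.eval_X, cubic]
  ring
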